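/- Let (B₀,{-,-}) be a Poisson k-algebra, e : 0 → (t) → Ã → A → 0 a small extension, Λ an A-bilinear Poisson bracket on B₀⊗ₖA inducing {-,-} on B₀, and Λ₁ an Ã-bilinear antisymmetric biderivation on B₀⊗ₖÃ inducing Λ on B₀⊗ₖA. Then the map sending a Poisson k-derivation P of B₀ to the Ã-linear endomorphism θ_P of B₀⊗ₖÃ determined by θ_P(x⊗1) = x⊗1 + P(x)⊗t is a group isomorphism from the additive group of Poisson k-derivations of (B₀,{-,-}) onto the group, under composition, of Ã-algebra automorphisms θ of B₀⊗ₖÃ satisfying θ(Λ₁(u,v)) = Λ₁(θ(u),θ(v)) for all u,v and inducing the identity on B₀⊗ₖA; in particular θ_P ∘ θ_Q = θ_{P+Q}. -/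

import Mathlib

open scoped TensorProduct

/-- An antisymmetric `R`-bilinear biderivation on a commutative `R`-algebra `C`:
a map which is antisymmetric, `R`-bilinear, and a derivation in each argument. -/
def IsAntisymBiderivation (R : Type*) {C : Type*} [CommSemiring R] [CommRing C]
    [Algebra R C] (P : C → C → C) : Prop :=
  (∀ x y, P x y = - P y x) ∧
  (∀ (r : R) (x x' y : C), P (r • x + x') y = r • P x y + P x' y) ∧
  (∀ (r : R) (x y y' : C), P x (r • y + y') = r • P x y + P x y') ∧
  (∀ x x' y : C, P (x * x') y = x * P x' y + x' * P x y) ∧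
  (∀ x y y' : C, P x (y * y') = y * P x y' + y' * P x y)

/-- The Jacobi identity for a bracket. -/
def SatisfiesJacobi {C : Type*} [CommRing C] (P : C → C → C) : Prop :=
  ∀ x y z, P x (P y z) + P y (P z x) + P z (P x y) = 0

/-- A Poisson bracket over `R`: an antisymmetric `R`-bilinear biderivation
satisfying the Jacobi identity. -/
def IsPoissonBracket (R : Type*) {C : Type*} [CommSemiring R] [CommRing C]
    [Algebra R C] (P : C → C → C) : Prop :=
  IsAntisymBiderivation R P ∧ SatisfiesJacobi P

section Biderivation

variable {R C k B : Type*} [CommRing R] [CommRing C] [Algebra R C]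
  [Field k] [CommRing B] [Algebra k B] [Algebra k C]
  {Λ : C → C → C} {br : B → B → B}

theorem IsAntisymBiderivation.add_left (h : IsAntisymBiderivation R Λ) (x x' y : C) :
    Λ (x + x') y = Λ x y + Λ x' y := by
  simpa using h.2.1 1 x x' y

theorem IsAntisymBiderivation.add_right (h : IsAntisymBiderivation R Λ) (x y y' : C) :
    Λ x (y + y') = Λ x y + Λ x y' := by
  simpa using h.2.2.1 1 x y y'

theorem IsAntisymBiderivation.zero_right (h : IsAntisymBiderivation R Λ) (x : C) :
    Λ x 0 = 0 := by
  simpa using h.add_right x 0 0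

theorem IsAntisymBiderivation.smul_right (h : IsAntisymBiderivation R Λ) (r : R) (x y : C) :
    Λ x (r • y) = r • Λ x y := by
  simpa [h.zero_right] using h.2.2.1 r x y 0

variable {σ : C →ₐ[k] B} {ι : B →ₗ[k] C}

/-- Bracket of elements perturbed by a square-zero ideal `ι B`, on which `Λ` acts through `br`. -/
theorem IsAntisymBiderivation.perturb (hΛ : IsAntisymBiderivation R Λ)
    (hbr : IsAntisymBiderivation k br) (hσι : ∀ x, σ (ι x) = 0)
    (hΛι : ∀ u x, Λ u (ι x) = ι (br (σ u) x)) (u v : C) (p q : B) :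
    Λ (u + ι p) (v + ι q) = Λ u v + ι (br p (σ v) + br (σ u) q) := by
  rw [hΛ.add_right, hΛ.add_left, hΛι, hΛ.1 (ι p) v, hΛι, hbr.1 (σ v) p, map_add, hσι, add_zero,
    map_neg, neg_neg, map_add, add_assoc]

end Biderivation

section InfinitesimalAut

variable {R C k B : Type*} [CommRing R] [CommRing C] [Algebra R C]
  [Field k] [CommRing B] [Algebra k B] [Algebra k C]
  (σ : C →ₐ[k] B) (ι : B →ₗ[k] C) (hmul : ∀ u x, u * ι x = ι (σ u * x))
  (hσι : ∀ x, σ (ι x) = 0) (ε : R → k) (hσ : ∀ r : R, σ (algebraMap R C r) = algebraMap k B (ε r))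

/-- The algebra endomorphism `u ↦ u + ι (P (σ u))` attached to a derivation `P`, where `ι` embeds
`B` as a square-zero ideal on which `C` acts through `σ`. -/
def infinitesimalHom (P : Derivation k B B) : C →ₐ[R] C where
  toFun u := u + ι (P (σ u))
  map_one' := by simp
  map_zero' := by simp
  map_add' u v := by simp only [map_add]; abel
  map_mul' u v := by
    have hι : ι (P (σ u)) * ι (P (σ v)) = 0 := by rw [hmul, hσι, zero_mul, map_zero]
    rw [add_mul, mul_add, mul_add, hι, mul_comm (ι _) v, hmul, hmul, map_mul, P.leibniz, map_add,
      smul_eq_mul, smul_eq_mul]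
    abel
  commutes' r := by rw [hσ, P.map_algebraMap, map_zero, add_zero]

/-- The algebra automorphism `u ↦ u + ι (P (σ u))`, with inverse given by `-P`. -/
def infinitesimalAut (P : Derivation k B B) : C ≃ₐ[R] C :=
  AlgEquiv.ofAlgHom (infinitesimalHom σ ι hmul hσι ε hσ P) (infinitesimalHom σ ι hmul hσι ε hσ (-P))
    (by ext u; simp [infinitesimalHom, hσι]) (by ext u; simp [infinitesimalHom, hσι])

theorem infinitesimalAut_apply (P : Derivation k B B) (u : C) :
    infinitesimalAut σ ι hmul hσι ε hσ P u = u + ι (P (σ u)) := rfl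

/-- The automorphism attached to `P` preserves the bracket exactly when `P` is Poisson. -/
theorem infinitesimalAut_map_bracket_iff (hι : Function.Injective ι) (hσs : Function.Surjective σ)
    {Λ : C → C → C} {br : B → B → B} (hΛ : IsAntisymBiderivation R Λ)
    (hbr : IsAntisymBiderivation k br) (hΛσ : ∀ u v, σ (Λ u v) = br (σ u) (σ v))
    (hΛι : ∀ u x, Λ u (ι x) = ι (br (σ u) x)) (P : Derivation k B B) :
    (∀ u v, infinitesimalAut σ ι hmul hσι ε hσ P (Λ u v) =
      Λ (infinitesimalAut σ ι hmul hσι ε hσ P u) (infinitesimalAut σ ι hmul hσι ε hσ P v)) ↔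
    ∀ x y, P (br x y) = br (P x) y + br x (P y) := by
  simp_rw [infinitesimalAut_apply, hΛ.perturb hbr hσι hΛι, hΛσ, add_right_inj, hι.eq_iff]
  exact (hσs.forall₂ (p := fun x y => P (br x y) = br (P x) y + br x (P y))).symm

/-- An algebra homomorphism differing from `s` by elements of `ι B` is `s + ι ∘ P` for a
derivation `P`. -/
theorem exists_derivation_of_sub_mem_range (hmul : ∀ u x, u * ι x = ι (σ u * x))
    (hσι : ∀ x, σ (ι x) = 0) (hι : Function.Injective ι)
    (s f : B →ₐ[k] C) (hs : ∀ x, σ (s x) = x)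
    (hf : ∀ x, f x - s x ∈ LinearMap.range ι) :
    ∃ P : Derivation k B B, ∀ x, f x = s x + ι (P x) := by
  obtain ⟨D, hD⟩ : ∃ D : B →ₗ[k] B, ∀ x, f x = s x + ι (D x) := by
    refine ⟨(LinearEquiv.ofInjective ι hι).symm.toLinearMap ∘ₗ
      (f.toLinearMap - s.toLinearMap).codRestrict _ hf, fun x => ?_⟩
    have := congrArg Subtype.val ((LinearEquiv.ofInjective ι hι).apply_symm_apply ⟨_, hf x⟩)
    rw [LinearEquiv.ofInjective_apply] at this
    exact (sub_eq_iff_eq_add'.mp this.symm)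
  refine ⟨Derivation.mk' D fun x y => hι ?_, hD⟩
  have hιι : ι (D x) * ι (D y) = 0 := by rw [hmul, hσι, zero_mul, map_zero]
  have h := map_mul f x y
  rw [hD, hD x, hD y, map_mul, add_mul, mul_add, mul_add, hιι, mul_comm (ι _) (s y), hmul, hmul,
    hs, hs, add_zero, add_assoc, add_right_inj] at h
  rw [h, smul_eq_mul, smul_eq_mul, map_add]

end InfinitesimalAut

section SmallExtension

open LinearMap

variable {k A B : Type*} [Field k] [CommRing A] [Algebra k A] [CommRing B] [Algebra k B]

/-- The map `x ↦ t ⊗ x`. -/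
noncomputable def tmulLeft (B : Type*) [CommRing B] [Algebra k B] (t : A) : B →ₗ[k] A ⊗[k] B :=
  TensorProduct.mk k A B t

theorem tmulLeft_eq_rTensor (t : A) :
    tmulLeft B t = (toSpanSingleton k A t).rTensor B ∘ₗ (TensorProduct.lid k B).symm := by
  ext x
  simp [tmulLeft]

theorem tmulLeft_injective {t : A} (ht : t ≠ 0) :
    Function.Injective (tmulLeft (k := k) B t) := by
  rw [tmulLeft_eq_rTensor, coe_comp]
  exact (Module.Flat.rTensor_preserves_injective_linearMap _
    (smul_left_injective k ht)).comp (TensorProduct.lid k B).symm.injective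

/-- If the ideal `(t)` is the line `k t`, the kernel of `A ⊗ B → A/(t) ⊗ B` is `t ⊗ B`. -/
theorem mem_range_tmulLeft {t : A} (ht : ∀ a : A, ∃ c : k, a * t = c • t)
    {π : A ⊗[k] B →ₐ[k] (A ⧸ Ideal.span {t}) ⊗[k] B}
    (hπ : ∀ (a : A) (x : B), π (a ⊗ₜ x) = Ideal.Quotient.mk (Ideal.span {t}) a ⊗ₜ x)
    {u : A ⊗[k] B} (hu : π u = 0) : u ∈ LinearMap.range (tmulLeft (k := k) B t) := by
  have hex : Function.Exact (toSpanSingleton k A t)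
      (Ideal.Quotient.mkₐ k (Ideal.span {t})).toLinearMap := by
    intro a
    change Ideal.Quotient.mk (Ideal.span {t}) a = 0 ↔ _
    rw [Ideal.Quotient.eq_zero_iff_mem, Ideal.mem_span_singleton']
    constructor
    · rintro ⟨b, rfl⟩
      obtain ⟨c, hc⟩ := ht b
      exact ⟨c, hc.symm⟩
    · rintro ⟨c, rfl⟩
      exact ⟨algebraMap k A c, by simp [Algebra.smul_def]⟩
  have hπ' : π.toLinearMap = (Ideal.Quotient.mkₐ k (Ideal.span {t})).toLinearMap.rTensor B :=
    TensorProduct.ext' fun a x => hπ a x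
  obtain ⟨w, rfl⟩ := (rTensor_exact B hex (Ideal.Quotient.mkₐ_surjective k _) u).mp
    (by rw [← hπ']; exact hu)
  exact ⟨TensorProduct.lid k B w, by rw [tmulLeft_eq_rTensor]; simp⟩

end SmallExtension

/-- the automorphism group of a lift `Λ₁` of a Poisson structure `Λ` along
a small extension, consisting of those automorphisms inducing the identity on `B₀ ⊗ₖ A`,
is isomorphic as a group to the additive group of Poisson derivations of `B₀`, via
`P ↦ (x ⊗ 1 ↦ x ⊗ 1 + P x ⊗ t)`; in particular `θ_P ∘ θ_Q = θ_{P+Q}`. -/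
theorem automorphism_group_of_lift_is_Poisson_derivations
    (k : Type*) [Field k] [IsAlgClosed k] [CharZero k]
    (B₀ : Type*) [CommRing B₀] [Algebra k B₀]
    (br : B₀ → B₀ → B₀) (hbr : IsPoissonBracket k br)
    (Atil : Type*) [CommRing Atil] [Algebra k Atil] [IsLocalRing Atil] [IsArtinianRing Atil]
    (ε : Atil →ₐ[k] k)
    (hε : RingHom.ker (ε : Atil →+* k) = IsLocalRing.maximalIdeal Atil)
    (t : Atil) (ht0 : t ≠ 0) (htmem : t ∈ IsLocalRing.maximalIdeal Atil)
    (htann : ∀ m ∈ IsLocalRing.maximalIdeal Atil, m * t = 0)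
    (εA : (Atil ⧸ Ideal.span {t}) →ₐ[k] k)
    (hεA : εA.comp (Ideal.Quotient.mkₐ k (Ideal.span {t})) = ε)
    (π : (Atil ⊗[k] B₀) →ₐ[k] ((Atil ⧸ Ideal.span {t}) ⊗[k] B₀))
    (hπ : ∀ (a : Atil) (x : B₀), π (a ⊗ₜ x) = (Ideal.Quotient.mk (Ideal.span {t}) a) ⊗ₜ x)
    (ρ : ((Atil ⧸ Ideal.span {t}) ⊗[k] B₀) →ₐ[k] B₀)
    (hρ : ∀ (a : Atil ⧸ Ideal.span {t}) (x : B₀), ρ (a ⊗ₜ x) = εA a • x)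
    (Λ : ((Atil ⧸ Ideal.span {t}) ⊗[k] B₀) → ((Atil ⧸ Ideal.span {t}) ⊗[k] B₀) →
        ((Atil ⧸ Ideal.span {t}) ⊗[k] B₀))
    (hΛ : IsAntisymBiderivation (Atil ⧸ Ideal.span {t}) Λ)
    (hΛJ : SatisfiesJacobi Λ)
    (hΛbr : ∀ u v, ρ (Λ u v) = br (ρ u) (ρ v))
    (Λ₁ : (Atil ⊗[k] B₀) → (Atil ⊗[k] B₀) → (Atil ⊗[k] B₀))
    (hΛ₁ : IsAntisymBiderivation Atil Λ₁)
    (hΛ₁π : ∀ u v, π (Λ₁ u v) = Λ (π u) (π v)) :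
    ∃ e : {P : Derivation k B₀ B₀ // ∀ x y, P (br x y) = br (P x) y + br x (P y)} ≃
          {θ : (Atil ⊗[k] B₀) ≃ₐ[Atil] (Atil ⊗[k] B₀) //
            (∀ u v, θ (Λ₁ u v) = Λ₁ (θ u) (θ v)) ∧ ∀ u, π (θ u) = π u},
      (∀ (P : {P : Derivation k B₀ B₀ // ∀ x y, P (br x y) = br (P x) y + br x (P y)})
          (x : B₀),
        (e P).1 ((1 : Atil) ⊗ₜ x) = (1 : Atil) ⊗ₜ x + t ⊗ₜ (P.1 x)) ∧
      (∀ P Q R : {P : Derivation k B₀ B₀ // ∀ x y, P (br x y) = br (P x) y + br x (P y)},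
        R.1 = P.1 + Q.1 → ∀ u, (e R).1 u = (e P).1 ((e Q).1 u)) := by
  have hεt : ε t = 0 := by
    rw [← hε] at htmem
    exact htmem
  have hmult (a : Atil) : a * t = ε a • t := by
    have hm : a - algebraMap k Atil (ε a) ∈ IsLocalRing.maximalIdeal Atil := by
      rw [← hε, RingHom.mem_ker]
      simp
    have h := htann _ hm
    rwa [sub_mul, sub_eq_zero, ← Algebra.smul_def] at h
  set σ : Atil ⊗[k] B₀ →ₐ[k] B₀ := ρ.comp π with hσ_def
  set ι : B₀ →ₗ[k] Atil ⊗[k] B₀ := tmulLeft B₀ t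
  have hσ (a : Atil) (x : B₀) : σ (a ⊗ₜ x) = ε a • x := by
    rw [hσ_def, AlgHom.comp_apply, hπ, hρ, ← hεA]
    rfl
  have hι (x : B₀) : ι x = t ⊗ₜ x := rfl
  have hsec (x : B₀) : σ ((1 : Atil) ⊗ₜ x) = x := by simp [hσ]
  have hσι (x : B₀) : σ (ι x) = 0 := by simp [hι, hσ, hεt]
  have hσR (a : Atil) : σ (algebraMap Atil (Atil ⊗[k] B₀) a) = algebraMap k B₀ (ε a) := by
    rw [Algebra.TensorProduct.algebraMap_apply, Algebra.algebraMap_self_apply, hσ,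
      Algebra.algebraMap_eq_smul_one]
  have hmul (u : Atil ⊗[k] B₀) (x : B₀) : u * ι x = ι (σ u * x) := by
    induction u with
    | zero => simp
    | add u v hu hv => simp only [add_mul, map_add, hu, hv]
    | tmul a y =>
      rw [hι, hι, hσ, Algebra.TensorProduct.tmul_mul_tmul, hmult, smul_mul_assoc,
        TensorProduct.smul_tmul]
  have htsmul (u : Atil ⊗[k] B₀) : t • u = ι (σ u) := by
    have h := hmul u 1
    rw [mul_one, hι, mul_comm] at h
    rw [Algebra.smul_def, Algebra.TensorProduct.algebraMap_apply, Algebra.algebraMap_self_apply, h]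
  have hΛσ (u v : Atil ⊗[k] B₀) : σ (Λ₁ u v) = br (σ u) (σ v) := by
    simp only [hσ_def, AlgHom.comp_apply, hΛ₁π, hΛbr]
  have hΛι (u : Atil ⊗[k] B₀) (x : B₀) : Λ₁ u (ι x) = ι (br (σ u) x) := by
    rw [← hsec x, ← htsmul, hΛ₁.smul_right, htsmul, hΛσ]
  have hιinj : Function.Injective ι := tmulLeft_injective ht0
  have hσs : Function.Surjective σ := fun x => ⟨_, hsec x⟩
  have hπι (x : B₀) : π (ι x) = 0 := by
    rw [hι, hπ, Ideal.Quotient.eq_zero_iff_mem.mpr (Ideal.mem_span_singleton_self t),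
      TensorProduct.zero_tmul]
  let aut := infinitesimalAut σ ι hmul hσι ε hσR
  have haut (P : Derivation k B₀ B₀) (u : Atil ⊗[k] B₀) : aut P u = u + ι (P (σ u)) := rfl
  have hiff := infinitesimalAut_map_bracket_iff σ ι hmul hσι ε hσR hιinj hσs hΛ₁ hbr.1 hΛσ hΛι
  let F : {P : Derivation k B₀ B₀ // ∀ x y, P (br x y) = br (P x) y + br x (P y)} →
      {θ : (Atil ⊗[k] B₀) ≃ₐ[Atil] (Atil ⊗[k] B₀) //
        (∀ u v, θ (Λ₁ u v) = Λ₁ (θ u) (θ v)) ∧ ∀ u, π (θ u) = π u} :=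
    fun P => ⟨aut P.1, (hiff P.1).mpr P.2, fun u => by rw [haut, map_add, hπι, add_zero]⟩
  have hF : Function.Bijective F := by
    constructor
    · intro P Q hPQ
      ext x
      have h : aut P.1 ((1 : Atil) ⊗ₜ x) = aut Q.1 ((1 : Atil) ⊗ₜ x) := by
        rw [show aut P.1 = aut Q.1 from congrArg Subtype.val hPQ]
      rw [haut, haut, add_right_inj, hsec] at h
      exact hιinj h
    · rintro ⟨θ, hθΛ, hθπ⟩
      obtain ⟨P, hP⟩ := exists_derivation_of_sub_mem_range σ ι hmul hσι hιinj
        Algebra.TensorProduct.includeRight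
        ((θ.toAlgHom.restrictScalars k).comp Algebra.TensorProduct.includeRight) hsec
        fun x => mem_range_tmulLeft (fun a => ⟨ε a, hmult a⟩) hπ (by
          rw [map_sub, sub_eq_zero]
          exact hθπ _)
      have hθ : aut P = θ := by
        apply AlgEquiv.coe_toAlgHom_injective
        apply Algebra.TensorProduct.ext
        · ext
        · ext x
          refine Eq.trans ?_ (hP x).symm
          change aut P (1 ⊗ₜ x) = _
          rw [haut, hsec]
          rfl
      subst hθ
      exact ⟨⟨P, (hiff P).mp hθΛ⟩, rfl⟩
  refine ⟨Equiv.ofBijective F hF, fun P x => ?_, fun P Q R hR u => ?_⟩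
  · change aut P.1 _ = _
    rw [haut, hsec, hι]
  · change aut R.1 u = aut P.1 (aut Q.1 u)
    rw [haut, haut, haut, hR, map_add, hσι, add_zero, Derivation.add_apply, map_add]
    abel
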